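/- Let X be an infinite dimensional Banach space with a normalized unconditional Schauder basis (x_n), let m ∈ ℕ and q > 0, and suppose every continuous m-homogeneous scalar-valued polynomial on X is absolutely (q;1)-summing. Then: (a) if q < 1, then for every t > q/(1−q) and every x = ∑_j a_j x_j ∈ X one has ∑_j |a_j|^{mt} < ∞; (b) if q ≤ 1/2, then for every t > q and every x = ∑_j a_j x_j ∈ X one has ∑_j |a_j|^{mt} < ∞. -/

import Mathlib

open scoped BigOperators

/-- A sequence in a normed space is *weakly 1-summable*. -/
def WeaklySummable (𝕂 : Type*) [RCLike 𝕂] {X : Type*} [NormedAddCommGroup X]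
    [NormedSpace 𝕂 X] (x : ℕ → X) : Prop :=
  ∀ φ : X →L[𝕂] 𝕂, Summable fun j => ‖φ (x j)‖

/-- `P` is a continuous `m`-homogeneous polynomial. -/
def IsHomogPoly (𝕂 : Type*) [RCLike 𝕂] {X Y : Type*} [NormedAddCommGroup X] [NormedSpace 𝕂 X]
    [NormedAddCommGroup Y] [NormedSpace 𝕂 Y] (m : ℕ) (P : X → Y) : Prop :=
  ∃ T : ContinuousMultilinearMap 𝕂 (fun _ : Fin m => X) Y, ∀ x, P x = T fun _ => x

/-- `e` is a normalized unconditional Schauder basis of `X`. -/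
def IsNormalizedUncondBasis (𝕂 : Type*) [RCLike 𝕂] (X : Type*) [NormedAddCommGroup X]
    [NormedSpace 𝕂 X] (e : ℕ → X) : Prop :=
  (∀ n, ‖e n‖ = 1) ∧
  (∀ x : X, ∃! a : ℕ → 𝕂, HasSum (fun n => a n • e n) x) ∧
  ∃ ρ : ℝ, 1 ≤ ρ ∧ ∀ (a ε : ℕ → 𝕂) (x y : X),
    (∀ n, ε n = 1 ∨ ε n = -1) →
    HasSum (fun n => a n • e n) x → HasSum (fun n => (ε n * a n) • e n) y →
    ‖y‖ ≤ ρ * ‖x‖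


/-- Dini's test: a nonnegative series divided by powers (with exponent above one) of its partial
sums converges. -/
lemma summable_div_partialSum_rpow {c : ℕ → ℝ} (hc : ∀ j, 0 ≤ c j) {p : ℝ} (hp : 1 < p) :
    Summable fun j => c j / (1 + ∑ i ∈ Finset.range (j + 1), c i) ^ p := by
  set S : ℕ → ℝ := fun n => 1 + ∑ i ∈ Finset.range n, c i with hS
  have hSpos : ∀ n, 0 < S n := fun n => by
    have := Finset.sum_nonneg fun i (_ : i ∈ Finset.range n) => hc i
    simp only [hS]; linarith
  have hS0 : S 0 = 1 := by simp [hS]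
  have hSs : ∀ n, S (n + 1) = S n + c n := fun n => by
    simp only [hS, Finset.sum_range_succ]; ring
  have hd : 0 < p - 1 := by linarith
  have step : ∀ j, (p - 1) * (c j / S (j + 1) ^ p) ≤ S j ^ (-(p - 1)) - S (j + 1) ^ (-(p - 1)) := by
    intro j
    have h0 := hSpos j
    have h1 := hSpos (j + 1)
    have hy : 0 < S j / S (j + 1) := div_pos h0 h1
    have bern : 1 + (p - 1) * (1 - S j / S (j + 1)) ≤ (S j / S (j + 1)) ^ (-(p - 1)) := by
      rw [Real.rpow_def_of_pos hy]
      have e1 := Real.add_one_le_exp (Real.log (S j / S (j + 1)) * -(p - 1))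
      have e2 := Real.log_le_sub_one_of_pos hy
      nlinarith
    have hpow : S (j + 1) ^ p = S (j + 1) ^ (p - 1) * S (j + 1) := by
      rw [← Real.rpow_add_one h1.ne']; ring_nf
    have hdp : 0 < S (j + 1) ^ (p - 1) := Real.rpow_pos_of_pos h1 _
    rw [Real.div_rpow h0.le h1.le] at bern
    rw [hpow]
    have hc' : c j = S (j + 1) - S j := by rw [hSs]; ring
    rw [hc']
    have e3 := mul_le_mul_of_nonneg_right bern (Real.rpow_pos_of_pos h1 (-(p - 1))).le
    rw [div_mul_cancel₀ _ (Real.rpow_pos_of_pos h1 _).ne'] at e3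
    have e4 : S (j + 1) ^ (-(p - 1)) = (S (j + 1) ^ (p - 1))⁻¹ := Real.rpow_neg h1.le _
    have e5 : (p - 1) * ((S (j + 1) - S j) / (S (j + 1) ^ (p - 1) * S (j + 1))) =
        (1 + (p - 1) * (1 - S j / S (j + 1))) * S (j + 1) ^ (-(p - 1)) -
          S (j + 1) ^ (-(p - 1)) := by
      rw [e4]; field_simp; ring
    rw [e5]; linarith
  have hnn : ∀ j, 0 ≤ c j / S (j + 1) ^ p := fun j =>
    div_nonneg (hc j) (Real.rpow_nonneg (hSpos _).le _)
  refine summable_of_sum_range_le (c := 1 / (p - 1)) hnn fun n => ?_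
  rw [le_div_iff₀' hd, Finset.mul_sum]
  refine (Finset.sum_le_sum fun j _ => step j).trans ?_
  rw [Finset.sum_range_sub' (fun j => S j ^ (-(p - 1))), hS0, Real.one_rpow]
  linarith [Real.rpow_nonneg (hSpos n).le (-(p - 1))]

/-- Abel's test: if a nonnegative series divided by its partial sums converges, so does the
series itself. -/
lemma summable_of_summable_div_partialSum {c : ℕ → ℝ} (hc : ∀ j, 0 ≤ c j)
    (h : Summable fun j => c j / (1 + ∑ i ∈ Finset.range (j + 1), c i)) : Summable c := by
  set S : ℕ → ℝ := fun n => 1 + ∑ i ∈ Finset.range n, c i with hS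
  have hSpos : ∀ n, 0 < S n := fun n => by
    have := Finset.sum_nonneg fun i (_ : i ∈ Finset.range n) => hc i
    simp only [hS]; linarith
  have hSs : ∀ n, S (n + 1) = S n + c n := fun n => by
    simp only [hS, Finset.sum_range_succ]; ring
  have hmono : Monotone S := monotone_nat_of_le_succ fun n => by rw [hSs]; linarith [hc n]
  obtain ⟨N, hN⟩ := ((tendsto_sum_nat_add fun j => c j / S (j + 1)).eventually
    (gt_mem_nhds (show (0 : ℝ) < 1 / 2 by norm_num))).exists
  have tail : ∀ k, S (k + N) ≤ 2 * S N := by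
    intro k
    have h1 : (S (k + N) - S N) / S (k + N) ≤ 1 / 2 := by
      refine le_trans ?_ hN.le
      refine le_trans ?_ (((summable_nat_add_iff N).2 h).sum_le_tsum (Finset.range k)
        fun i _ => div_nonneg (hc _) (hSpos _).le)
      have : S (k + N) - S N = ∑ i ∈ Finset.range k, c (i + N) := by
        have := Finset.sum_range_sub (fun i => S (i + N)) k
        simp only [zero_add] at this
        rw [← this]
        refine Finset.sum_congr rfl fun i _ => ?_
        rw [add_right_comm, hSs]; ring
      rw [this, Finset.sum_div]
      refine Finset.sum_le_sum fun i hi => ?_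
      exact div_le_div_of_nonneg_left (hc _) (hSpos _)
        (hmono (by have := Finset.mem_range.1 hi; omega))
    rw [div_le_iff₀ (hSpos _)] at h1
    linarith
  refine summable_of_sum_range_le (c := 2 * S N) hc fun n => ?_
  have h1 := (hmono (Nat.le_add_right n N)).trans (tail n)
  simp only [hS] at h1 ⊢
  linarith

/-- A form of the duality between `ℓ^{1/q}` and `ℓ^{1/(1-q)}`. -/
lemma summable_rpow_of_forall_summable_mul_rpow {b : ℕ → ℝ} (hb : ∀ j, 0 ≤ b j) {q : ℝ}
    (hq : 0 < q) (hq1 : q < 1)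
    (h : ∀ ν : ℕ → ℝ, (∀ j, 0 ≤ ν j) → Summable ν → Summable fun j => (ν j * b j) ^ q) :
    Summable fun j => b j ^ (q / (1 - q)) := by
  have hq' : 0 < 1 - q := by linarith
  have hc : ∀ j, 0 ≤ b j ^ (q / (1 - q)) := fun j => Real.rpow_nonneg (hb j) _
  have hS : ∀ n, 0 ≤ 1 + ∑ i ∈ Finset.range n, b i ^ (q / (1 - q)) := fun n =>
    add_nonneg zero_le_one (Finset.sum_nonneg fun i _ => hc i)
  refine summable_of_summable_div_partialSum hc ?_
  refine (h _ (fun j => div_nonneg (hc j) (Real.rpow_nonneg (hS _) _))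
    (summable_div_partialSum_rpow hc (p := 1 / q) (by rw [lt_div_iff₀ hq]; linarith))).congr
    fun j => ?_
  rw [div_mul_eq_mul_div, Real.div_rpow (mul_nonneg (hc j) (hb j)) (Real.rpow_nonneg (hS _) _),
    ← Real.rpow_mul (hS _), one_div_mul_cancel hq.ne', Real.rpow_one,
    Real.mul_rpow (hc j) (hb j), ← Real.rpow_mul (hb j)]
  congr 1
  rcases (hb j).eq_or_lt with h0 | h0
  · rw [← h0, Real.zero_rpow hq.ne', Real.zero_rpow (div_pos hq hq').ne', mul_zero]
  · rw [← Real.rpow_add h0]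
    congr 1
    field_simp
    ring

lemma Summable.rpow_of_le {b : ℕ → ℝ} (hb : ∀ j, 0 ≤ b j) {s t : ℝ} (hs : 0 < s) (hst : s ≤ t)
    (h : Summable fun j => b j ^ s) : Summable fun j => b j ^ t := by
  refine Summable.of_norm_bounded_eventually_nat h ?_
  filter_upwards [h.tendsto_atTop_zero.eventually (gt_mem_nhds zero_lt_one)] with j hj
  have hb1 : b j ≤ 1 := by
    by_contra! hlt
    exact absurd hj (not_lt.2 (Real.one_le_rpow hlt.le hs.le))
  rw [Real.norm_of_nonneg (Real.rpow_nonneg (hb j) _)]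
  rcases (hb j).eq_or_lt with h0 | h0
  · rw [← h0, Real.zero_rpow hs.ne', Real.zero_rpow (hs.trans_le hst).ne']
  · exact Real.rpow_le_rpow_of_exponent_ge h0 hb1 hst

lemma prod_le_sum_pow_card {ι : Type*} [Fintype ι] [Nonempty ι] {r : ι → ℝ}
    (hr : ∀ i, 0 ≤ r i) : ∏ i, r i ≤ ∑ i, r i ^ Fintype.card ι := by
  obtain ⟨i₀, hi₀⟩ := Finite.exists_max r
  calc ∏ i, r i ≤ ∏ _i : ι, r i₀ := Finset.prod_le_prod (fun i _ => hr i) fun i _ => hi₀ i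
    _ = r i₀ ^ Fintype.card ι := by simp
    _ ≤ ∑ i, r i ^ Fintype.card ι :=
      Finset.single_le_sum (f := fun i => r i ^ Fintype.card ι)
        (fun i _ => pow_nonneg (hr i) _) (Finset.mem_univ i₀)

section Polynomials

variable {𝕂 : Type*} [RCLike 𝕂] {X : Type*} [NormedAddCommGroup X] [NormedSpace 𝕂 X]

/-- Functionals which are pointwise `m`-summable are uniformly so on bounded sets. -/
lemma exists_tsum_norm_pow_le [CompleteSpace X] {m : ℕ} (hm : 0 < m) (c : ℕ → X →L[𝕂] 𝕂)
    (hc : ∀ x, Summable fun j => ‖c j x‖ ^ m) :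
    ∃ C : ℝ, ∀ x, ∑' j, ‖c j x‖ ^ m ≤ C * ‖x‖ ^ m := by
  have : Fact (1 ≤ (m : ENNReal)) := ⟨by exact_mod_cast hm⟩
  have hm' : 0 < (m : ENNReal).toReal := by simpa using hm
  have mem : ∀ x, Memℓp (fun j => c j x) (m : ENNReal) := fun x =>
    (memℓp_gen_iff hm').2 (by simpa using hc x)
  let A : X →ₗ[𝕂] lp (fun _ : ℕ => 𝕂) (m : ENNReal) :=
    { toFun := fun x => ⟨fun j => c j x, mem x⟩
      map_add' := fun x y => by ext j; exact map_add (c j) x y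
      map_smul' := fun r x => by ext j; simp }
  have hA : Continuous A := by
    refine A.continuous_of_seq_closed_graph fun u x y hu hy => ?_
    ext j
    refine tendsto_nhds_unique ?_ (((c j).continuous.tendsto x).comp hu)
    exact ((lp.evalCLM 𝕂 (fun _ : ℕ => 𝕂) (m : ENNReal) j).continuous.tendsto y).comp hy
  let B : X →L[𝕂] lp (fun _ : ℕ => 𝕂) (m : ENNReal) := ⟨A, hA⟩
  refine ⟨‖B‖ ^ m, fun x => ?_⟩
  have h := lp.norm_rpow_eq_tsum hm' (B x)
  simp only [ENNReal.toReal_natCast, Real.rpow_natCast] at h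
  rw [← mul_pow]
  calc ∑' j, ‖c j x‖ ^ m = ‖B x‖ ^ m := h.symm
    _ ≤ _ := pow_le_pow_left₀ (norm_nonneg _) (B.le_opNorm x) m

lemma isHomogPoly_tsum_pow [CompleteSpace X] {m : ℕ} (hm : 0 < m) (c : ℕ → X →L[𝕂] 𝕂)
    (hc : ∀ x, Summable fun j => ‖c j x‖ ^ m) :
    IsHomogPoly 𝕂 m fun x => ∑' j, c j x ^ m := by
  have : Nonempty (Fin m) := ⟨⟨0, hm⟩⟩
  obtain ⟨C, hC⟩ := exists_tsum_norm_pow_le hm c hc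
  let τ : ℕ → ContinuousMultilinearMap 𝕂 (fun _ : Fin m => X) 𝕂 := fun j =>
    (ContinuousMultilinearMap.mkPiAlgebra 𝕂 (Fin m) 𝕂).compContinuousLinearMap fun _ => c j
  have hτ : ∀ j v, τ j v = ∏ i, c j (v i) := fun j v => by simp [τ]
  have hscale : ∀ j (y : X), ‖c j y‖ = ‖c j (((‖y‖⁻¹ : ℝ) : 𝕂) • y)‖ * ‖y‖ := by
    intro j y
    rcases eq_or_ne y 0 with rfl | hy
    · simp
    · rw [map_smul, norm_smul, RCLike.norm_ofReal, abs_of_nonneg (inv_nonneg.2 (norm_nonneg y))]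
      field_simp [norm_ne_zero_iff.2 hy]
  have hunit : ∀ y : X, ‖((‖y‖⁻¹ : ℝ) : 𝕂) • y‖ ≤ 1 := by
    intro y
    rw [norm_smul, RCLike.norm_ofReal, abs_of_nonneg (inv_nonneg.2 (norm_nonneg y))]
    exact inv_mul_le_one
  have bound : ∀ j v, ‖τ j v‖ ≤
      (∑ i, ‖c j (((‖v i‖⁻¹ : ℝ) : 𝕂) • v i)‖ ^ m) * ∏ i, ‖v i‖ := by
    intro j v
    rw [hτ, norm_prod, Finset.prod_congr rfl fun i _ => hscale j (v i), Finset.prod_mul_distrib]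
    refine mul_le_mul_of_nonneg_right ?_ (Finset.prod_nonneg fun i _ => norm_nonneg _)
    simpa using prod_le_sum_pow_card
      (r := fun i => ‖c j (((‖v i‖⁻¹ : ℝ) : 𝕂) • v i)‖) fun i => norm_nonneg _
  have hs : ∀ v : Fin m → X, Summable fun j =>
      (∑ i, ‖c j (((‖v i‖⁻¹ : ℝ) : 𝕂) • v i)‖ ^ m) * ∏ i, ‖v i‖ := fun v =>
    (summable_sum fun i _ => hc _).mul_right _
  have hτs : ∀ v, Summable fun j => τ j v := fun v =>
    Summable.of_norm_bounded (hs v) fun j => bound j v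
  let T : MultilinearMap 𝕂 (fun _ : Fin m => X) 𝕂 :=
    { toFun := fun v => ∑' j, τ j v
      map_update_add' := fun v i x y => by
        rw [← (hτs _).tsum_add (hτs _)]
        refine tsum_congr fun j => ?_
        convert (τ j).map_update_add v i x y
      map_update_smul' := fun v i r x => by
        rw [smul_eq_mul, ← tsum_mul_left]
        refine tsum_congr fun j => ?_
        rw [← smul_eq_mul]
        convert (τ j).map_update_smul v i r x }
  have hC0 : ∀ y : X, ‖y‖ ≤ 1 → ∑' j, ‖c j y‖ ^ m ≤ |C| := fun y hy =>
    (hC y).trans <| (mul_le_mul_of_nonneg_right (le_abs_self C) (by positivity)).trans <|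
      mul_le_of_le_one_right (abs_nonneg C) (pow_le_one₀ (norm_nonneg y) hy)
  refine ⟨T.mkContinuous (m * |C|) fun v => ?_, fun x => ?_⟩
  · calc ‖T v‖ ≤ ∑' j, (∑ i, ‖c j (((‖v i‖⁻¹ : ℝ) : 𝕂) • v i)‖ ^ m) * ∏ i, ‖v i‖ :=
        tsum_of_norm_bounded (hs v).hasSum fun j => bound j v
      _ = (∑ i, ∑' j, ‖c j (((‖v i‖⁻¹ : ℝ) : 𝕂) • v i)‖ ^ m) * ∏ i, ‖v i‖ := by
        rw [tsum_mul_right, Summable.tsum_finsetSum fun i _ => hc _]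
      _ ≤ m * |C| * ∏ i, ‖v i‖ := by
        refine mul_le_mul_of_nonneg_right ?_ (Finset.prod_nonneg fun i _ => norm_nonneg _)
        simpa using Finset.sum_le_sum fun i (_ : i ∈ Finset.univ) => hC0 _ (hunit (v i))
  · change ∑' j, c j x ^ m = ∑' j, τ j fun _ => x
    simp [hτ]

lemma weaklySummable_of_summable {x : ℕ → X} (hx : Summable x) : WeaklySummable 𝕂 x := fun φ =>
  (hx.map φ φ.continuous).norm

/-- The coefficients of an unconditional basis are given by uniformly bounded functionals. -/
lemma IsNormalizedUncondBasis.exists_coord [CompleteSpace X] {e : ℕ → X}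
    (he : IsNormalizedUncondBasis 𝕂 X e) :
    ∃ (c : ℕ → X →L[𝕂] 𝕂) (K : ℝ), (∀ j, ‖c j‖ ≤ K) ∧
      ∀ (x : X) (a : ℕ → 𝕂), HasSum (fun j => a j • e j) x → ∀ j, c j x = a j := by
  obtain ⟨hnorm, hex, ρ, hρ, hsign⟩ := he
  choose a ha huniq using hex
  have bound : ∀ j x, ‖a x j‖ ≤ (1 + ρ) / 2 * ‖x‖ := by
    intro j x
    have hy : HasSum (fun n => ((if n = j then -1 else 1 : 𝕂) * a x n) • e n)
        (x - (2 * a x j) • e j) := by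
      convert (ha x).sub (hasSum_ite_eq j ((2 * a x j) • e j)) using 2 with n
      split_ifs with h
      · subst h; rw [← sub_smul]; congr 1; ring
      · simp
    have h1 := hsign (a x) (fun n => if n = j then -1 else 1) x _
      (fun n => by by_cases h : n = j <;> simp [h]) (ha x) hy
    have h2 : ‖(2 * a x j) • e j‖ = 2 * ‖a x j‖ := by
      rw [norm_smul, hnorm, norm_mul, RCLike.norm_two, mul_one]
    have h3 := norm_sub_norm_le ((2 * a x j) • e j) x
    rw [norm_sub_rev, h2] at h3
    linarith
  let c : ℕ → X →L[𝕂] 𝕂 := fun j => LinearMap.mkContinuous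
    { toFun := fun x => a x j
      map_add' := fun x y => by
        refine (congrFun (huniq (x + y) (fun n => a x n + a y n) ?_) j).symm
        simpa only [add_smul] using (ha x).add (ha y)
      map_smul' := fun r x => by
        refine (congrFun (huniq (r • x) (fun n => r * a x n) ?_) j).symm
        simpa only [mul_smul] using (ha x).const_smul r }
    ((1 + ρ) / 2) (bound j)
  exact ⟨c, (1 + ρ) / 2, fun j => LinearMap.mkContinuous_norm_le _ (by linarith) _,
    fun x b hb j => (congrFun (huniq x b hb) j).symm⟩

/-- The summing hypothesis applied to the diagonal polynomial `x ↦ ∑ⱼ νⱼ (cⱼ x) ^ m`. -/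
lemma summable_mul_coeff_rpow [CompleteSpace X] {e : ℕ → X} {c : ℕ → X →L[𝕂] 𝕂}
    (hce : ∀ (x : X) (a : ℕ → 𝕂), HasSum (fun j => a j • e j) x → ∀ j, c j x = a j)
    {m : ℕ} (hm : 0 < m) {q : ℝ}
    (hsum : ∀ P : X → 𝕂, IsHomogPoly 𝕂 m P → ∀ x : ℕ → X, WeaklySummable 𝕂 x →
      Summable fun j => ‖P (x j)‖ ^ q)
    {ν : ℕ → ℝ} (hν : ∀ j, 0 ≤ ν j) (hνc : ∀ x, Summable fun j => ν j * ‖c j x‖ ^ m)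
    {x : X} {a : ℕ → 𝕂} (hx : HasSum (fun j => a j • e j) x) :
    Summable fun j => (ν j * ‖a j‖ ^ m) ^ q := by
  have hroot : ∀ j, (ν j ^ (m : ℝ)⁻¹) ^ m = ν j := fun j =>
    Real.rpow_inv_natCast_pow (hν j) hm.ne'
  let d : ℕ → X →L[𝕂] 𝕂 := fun j => ((ν j ^ (m : ℝ)⁻¹ : ℝ) : 𝕂) • c j
  have hd : ∀ j y, d j y ^ m = (ν j : 𝕂) * c j y ^ m := fun j y => by
    simp only [d, smul_apply, smul_eq_mul, mul_pow]
    rw [← RCLike.ofReal_pow, hroot]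
  have hdn : ∀ j y, ‖d j y‖ ^ m = ν j * ‖c j y‖ ^ m := fun j y => by
    rw [← norm_pow, hd, norm_mul, norm_pow, RCLike.norm_ofReal, abs_of_nonneg (hν j)]
  have hP := isHomogPoly_tsum_pow hm d fun y => by simpa only [hdn] using hνc y
  refine (hsum _ hP _ (weaklySummable_of_summable hx.summable)).congr fun k => ?_
  have hck : ∀ j, c j (a k • e k) = if j = k then a k else 0 := fun j => by
    refine hce _ (fun j => if j = k then a k else 0) ?_ j
    convert hasSum_ite_eq k (a k • e k) using 2 with n
    split_ifs with h
    · rw [h]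
    · simp
  rw [tsum_eq_single k fun j hj => by rw [hd, hck, if_neg hj, zero_pow hm.ne', mul_zero], hd, hck,
    if_pos rfl, norm_mul, norm_pow, RCLike.norm_ofReal, abs_of_nonneg (hν k)]

end Polynomials

/-- If every continuous scalar-valued `m`-homogeneous polynomial on `X` is absolutely
`(q;1)`-summing, then (a) if `q < 1`, the basis coefficients of every `x ∈ X` are
`mt`-summable for all `t > q/(1-q)`; (b) if `q ≤ 1/2`, the same holds for all `t > q`. -/
theorem stmt10 (𝕂 : Type*) [RCLike 𝕂]
    (X : Type*) [NormedAddCommGroup X] [NormedSpace 𝕂 X] [CompleteSpace X]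
    (hX : ¬FiniteDimensional 𝕂 X)
    (e : ℕ → X) (he : IsNormalizedUncondBasis 𝕂 X e)
    (m : ℕ) (hm : 0 < m) (q : ℝ) (hq : 0 < q)
    (hsum : ∀ P : X → 𝕂, IsHomogPoly 𝕂 m P → ∀ x : ℕ → X, WeaklySummable 𝕂 x →
      Summable fun j => ‖P (x j)‖ ^ q) :
    (q < 1 → ∀ t : ℝ, q / (1 - q) < t → ∀ (x : X) (a : ℕ → 𝕂),
      HasSum (fun j => a j • e j) x → Summable fun j => ‖a j‖ ^ ((m : ℝ) * t)) ∧
    (q ≤ 1 / 2 → ∀ t : ℝ, q < t → ∀ (x : X) (a : ℕ → 𝕂),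
      HasSum (fun j => a j • e j) x → Summable fun j => ‖a j‖ ^ ((m : ℝ) * t)) := by
  obtain ⟨c, K, hK, hce⟩ := he.exists_coord
  have endpoint : q < 1 → ∀ (x : X) (a : ℕ → 𝕂), HasSum (fun j => a j • e j) x →
      Summable fun j => (‖a j‖ ^ m) ^ (q / (1 - q)) := fun hq1 x a hx =>
    summable_rpow_of_forall_summable_mul_rpow (fun j => by positivity) hq hq1 fun ν hν hνs =>
      summable_mul_coeff_rpow hce hm hsum hν (fun y => by
        refine Summable.of_nonneg_of_le (fun j => mul_nonneg (hν j) (by positivity))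
          (fun j => ?_) (hνs.mul_right ((K * ‖y‖) ^ m))
        exact mul_le_mul_of_nonneg_left (pow_le_pow_left₀ (norm_nonneg _)
          ((c j).le_of_opNorm_le (hK j) y) m) (hν j)) hx
  have hpow : ∀ (a : ℕ → 𝕂) (t : ℝ),
      (fun j => ‖a j‖ ^ ((m : ℝ) * t)) = fun j => (‖a j‖ ^ m) ^ t := fun a t =>
    funext fun j => Real.rpow_natCast_mul (norm_nonneg _) _ _
  refine ⟨fun hq1 t ht x a hx => ?_, fun hq2 t ht x a hx => ?_⟩
  · rw [hpow]
    exact (endpoint hq1 x a hx).rpow_of_le (fun j => by positivity)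
      (div_pos hq (by linarith)) ht.le
  · rw [hpow]
    have hq1 : q < 1 := by linarith
    have hpow_summable : ∀ y, Summable fun j => 1 * ‖c j y‖ ^ m := fun y => by
      obtain ⟨b, hb, -⟩ := he.2.1 y
      have h1 := (endpoint hq1 y b hb).rpow_of_le (fun j => by positivity)
        (div_pos hq (by linarith)) (t := 1) (by rw [div_le_one (by linarith)]; linarith)
      simpa [hce y b hb] using h1
    have h2 := summable_mul_coeff_rpow hce hm hsum (ν := fun _ => 1) (fun _ => zero_le_one)
      hpow_summable hx
    simp only [one_mul] at h2
    exact h2.rpow_of_le (fun j => by positivity) hq ht.le
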